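/- (Detection loophole, arbitrary lost event efficiency.) Let S, T be finite index sets with real coefficients α_{st}, β_{st}, γ_{st}, let K > 0 and η ∈ (0,1]. Let ideal probabilities P_i^{st} (s ∈ S, t ∈ T) and P_i^{AB} be real numbers with P_i^{AB} > 0, and define the measured values P_m^{st} = P_i^{st}/η − (1−η)/(4η) and P_m^{AB} = P_i^{AB}/η − (1−η)/(4η); assume P_m^{AB} > 0. For c ∈ {α, β, γ} and x ∈ {i, m}, set I_c^x = Σ_{s,t} c_{st}·P_x^{st} and 𝒫_c = ((η−1)/(4η))·Σ_{s,t} c_{st}, and define N_x = I_α^x − (1/(K·P_x^{AB}))·[(I_β^x)² + (I_γ^x)²]. If N_i < 0, then N_m < η/(K·(η·P_m^{AB} + (1−η)/4)) · [(I_β^m − 𝒫_β)² + (I_γ^m − 𝒫_γ)²] − (1/(K·P_m^{AB}))·[(I_β^m)² + (I_γ^m)²] + 𝒫_α. -/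

import Mathlib

open Matrix Kronecker BigOperators ComplexOrder

noncomputable section

/-- A density matrix: a positive semidefinite complex matrix with trace 1. -/
def IsDensity {n : Type*} [Fintype n] (ρ : Matrix n n ℂ) : Prop :=
  ρ.PosSemidef ∧ ρ.trace = 1

/-- A separable density matrix on a product index type. -/
def IsSepDensity {α β : Type*} [Fintype α] [Fintype β]
    (ρ : Matrix (α × β) (α × β) ℂ) : Prop :=
  ∃ (m : ℕ) (p : Fin m → ℝ) (σA : Fin m → Matrix α α ℂ) (σB : Fin m → Matrix β β ℂ),
    (∀ i, 0 ≤ p i) ∧ (∑ i, p i) = 1 ∧ (∀ i, IsDensity (σA i)) ∧ (∀ i, IsDensity (σB i)) ∧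
    ρ = ∑ i, (p i : ℂ) • (σA i ⊗ₖ σB i)

/-- A separable positive semidefinite operator: a finite sum of Kronecker products of
positive semidefinite matrices. -/
def IsSepPSD {α β : Type*} [Fintype α] [Fintype β]
    (ρ : Matrix (α × β) (α × β) ℂ) : Prop :=
  ∃ (m : ℕ) (C : Fin m → Matrix α α ℂ) (D : Fin m → Matrix β β ℂ),
    (∀ i, (C i).PosSemidef) ∧ (∀ i, (D i).PosSemidef) ∧ ρ = ∑ i, C i ⊗ₖ D i

/-- `Λa` is the Hilbert–Schmidt adjoint of `Λ`. -/
def IsHSAdjoint {n : Type*} [Fintype n]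
    (Λ Λa : Matrix n n ℂ →ₗ[ℂ] Matrix n n ℂ) : Prop :=
  ∀ M N : Matrix n n ℂ, (M * Λ N).trace = (Λa M * N).trace

/-- The operator `τ ⊗ ρ ⊗ ω` with Alice's two tensor factors and Bob's two tensor
factors grouped together. -/
def Mop {α β : Type*} (τ : Matrix α α ℂ) (ρ : Matrix (α × β) (α × β) ℂ)
    (ω : Matrix β β ℂ) : Matrix ((α × α) × (β × β)) ((α × α) × (β × β)) ℂ :=
  Matrix.of fun x y =>
    τ x.1.1 y.1.1 * ρ (x.1.2, x.2.1) (y.1.2, y.2.1) * ω x.2.2 y.2.2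

/-- Partial trace over the second tensor factor. -/
def ptr2 {α β : Type*} [Fintype β] (A : Matrix (α × β) (α × β) ℂ) : Matrix α α ℂ :=
  Matrix.of fun a a' => ∑ b, A (a, b) (a', b)

/-- Partial trace over the first tensor factor. -/
def ptr1 {α β : Type*} [Fintype α] (A : Matrix (α × β) (α × β) ℂ) : Matrix β β ℂ :=
  Matrix.of fun b b' => ∑ a, A (a, b) (a, b')

/-- Partial transpose on the second subsystem. -/
def ptB {α β : Type*} (M : Matrix (α × β) (α × β) ℂ) : Matrix (α × β) (α × β) ℂ :=
  Matrix.of fun x y => M (x.1, y.2) (y.1, x.2)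


/-- Subtracting the offset of the lost events from a measured linear functional gives the
ideal one rescaled by the inverse efficiency. -/
theorem sum_measured_sub_offset {S T : Type*} [Fintype S] [Fintype T]
    {η : ℝ} {P Q : S → T → ℝ} (h : ∀ s t, Q s t = P s t / η - (1 - η) / (4 * η))
    (f : S → T → ℝ) :
    (∑ s, ∑ t, f s t * Q s t) - ((η - 1) / (4 * η)) * ∑ s, ∑ t, f s t
      = (∑ s, ∑ t, f s t * P s t) / η := by
  simp only [Finset.mul_sum, Finset.sum_div, ← Finset.sum_sub_distrib, h]
  refine Finset.sum_congr rfl fun s _ => Finset.sum_congr rfl fun t _ => ?_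
  ring

/-- Detection loophole with arbitrary lost event efficiency `η = η₋`. -/
theorem detection_loophole_lost_events
    {S T : Type*} [Fintype S] [Fintype T]
    (a b c : S → T → ℝ) (K η : ℝ) (hK : 0 < K) (hη : 0 < η) (hη1 : η ≤ 1)
    (Pi : S → T → ℝ) (PiAB : ℝ) (hPiAB : 0 < PiAB)
    (Pm : S → T → ℝ) (PmAB : ℝ)
    (hPm : ∀ s t, Pm s t = Pi s t / η - (1 - η) / (4 * η))
    (hPmAB : PmAB = PiAB / η - (1 - η) / (4 * η))
    (hPmABpos : 0 < PmAB)
    (hNi : (∑ s, ∑ t, a s t * Pi s t) - (1 / (K * PiAB)) *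
        ((∑ s, ∑ t, b s t * Pi s t) ^ 2 + (∑ s, ∑ t, c s t * Pi s t) ^ 2) < 0) :
    (∑ s, ∑ t, a s t * Pm s t) - (1 / (K * PmAB)) *
        ((∑ s, ∑ t, b s t * Pm s t) ^ 2 + (∑ s, ∑ t, c s t * Pm s t) ^ 2)
      < η / (K * (η * PmAB + (1 - η) / 4)) *
          (((∑ s, ∑ t, b s t * Pm s t) - ((η - 1) / (4 * η)) * ∑ s, ∑ t, b s t) ^ 2
            + ((∑ s, ∑ t, c s t * Pm s t) - ((η - 1) / (4 * η)) * ∑ s, ∑ t, c s t) ^ 2)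
        - (1 / (K * PmAB)) *
            ((∑ s, ∑ t, b s t * Pm s t) ^ 2 + (∑ s, ∑ t, c s t * Pm s t) ^ 2)
        + ((η - 1) / (4 * η)) * ∑ s, ∑ t, a s t := by
  have hAB : η * PmAB + (1 - η) / 4 = PiAB := by
    rw [hPmAB]
    field_simp
    ring
  have ha := sum_measured_sub_offset hPm a
  rw [sum_measured_sub_offset hPm b, sum_measured_sub_offset hPm c, hAB]
  set A := ∑ s, ∑ t, a s t * Pi s t
  set B := ∑ s, ∑ t, b s t * Pi s t
  set C := ∑ s, ∑ t, c s t * Pi s t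
  have hscale : η / (K * PiAB) * ((B / η) ^ 2 + (C / η) ^ 2)
      = (1 / (K * PiAB)) * (B ^ 2 + C ^ 2) / η := by
    field_simp
  have hlt : A / η < (1 / (K * PiAB)) * (B ^ 2 + C ^ 2) / η :=
    div_lt_div_of_pos_right (sub_neg.mp hNi) hη
  rw [hscale]
  linarith

end
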